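/- Let β > 0. There is a constant C depending only on β such that the following holds. If A, B : L × L → M₂(ℝ) are infinite matrices with |A|_{β+} < ∞ and |B|_β < ∞, then for all c, d ∈ L the entry sums (AB)(c,d) = ∑_{e ∈ L} A(c,e)·B(e,d) and (BA)(c,d) = ∑_{e ∈ L} B(c,e)·A(e,d) converge absolutely, and the products satisfy |AB|_β ≤ C·|A|_{β+}·|B|_β and |BA|_β ≤ C·|A|_{β+}·|B|_β. -/

import Mathlib

/-- Squared Frobenius norm of a real `2×2` matrix. -/
def frobSq (M : Matrix (Fin 2) (Fin 2) ℝ) : ℝ := ∑ i, ∑ j, M i j ^ 2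

/-- Hilbert–Schmidt norm of the block `A_{[a]}^{[b]}` of an infinite matrix
`A : L × L → M₂(ℝ)`, where `[a] = {c : w c = w a}`. -/
noncomputable def hsBlock {L : Type*} (w : L → ℕ)
    (A : L → L → Matrix (Fin 2) (Fin 2) ℝ) (a b : L) : ℝ :=
  Real.sqrt (∑' p : {c : L // w c = w a} × {d : L // w d = w b}, frobSq (A p.1.1 p.2.1))

/-- Entrywise product of two infinite matrices with `2×2` matrix entries. -/
noncomputable def infMul {L : Type*} (A B : L → L → Matrix (Fin 2) (Fin 2) ℝ)
    (c d : L) : Matrix (Fin 2) (Fin 2) ℝ :=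
  Matrix.of fun i j => ∑' e : L, (A c e * B e d) i j

open scoped ENNReal

lemma ENNReal.tsum_mul_sq_le {ι : Type*} (f g : ι → ℝ≥0∞) :
    (∑' i, f i * g i) ^ 2 ≤ (∑' i, f i ^ 2) * ∑' i, g i ^ 2 := by
  have key : ∑' i, f i * g i ≤
      (∑' i, f i ^ 2) ^ (1 / 2 : ℝ) * (∑' i, g i ^ 2) ^ (1 / 2 : ℝ) := by
    rw [ENNReal.tsum_eq_iSup_sum]
    refine iSup_le fun s => ?_
    have := ENNReal.inner_le_Lp_mul_Lq s f g (p := 2) (q := 2) Real.HolderConjugate.two_two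
    simp only [ENNReal.rpow_two] at this
    refine this.trans ?_
    gcongr <;> exact ENNReal.sum_le_tsum s
  calc _ ≤ _ := pow_le_pow_left' key 2
    _ = _ := by
      rw [mul_pow, ← ENNReal.rpow_two, ← ENNReal.rpow_two, ← ENNReal.rpow_mul,
        ← ENNReal.rpow_mul]
      norm_num

lemma ENNReal.tsum_sq_le_weighted {ι : Type*} (u t : ι → ℝ≥0∞) (hu0 : ∀ i, u i ≠ 0)
    (hut : ∀ i, u i ≠ ∞) :
    (∑' i, t i) ^ 2 ≤ (∑' i, u i) * ∑' i, t i ^ 2 / u i := by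
  have h := ENNReal.tsum_mul_sq_le (fun i => u i ^ (1 / 2 : ℝ))
    (fun i => t i / u i ^ (1 / 2 : ℝ))
  have e : ∀ i, (u i ^ (1 / 2 : ℝ)) ^ 2 = u i := fun i => by
    rw [← ENNReal.rpow_two, ← ENNReal.rpow_mul]; norm_num
  have e1 : ∀ i, u i ^ (1 / 2 : ℝ) * (t i / u i ^ (1 / 2 : ℝ)) = t i := fun i => by
    apply ENNReal.mul_div_cancel
    · simp [ENNReal.rpow_eq_zero_iff, hu0 i, hut i]
    · simp [ENNReal.rpow_eq_top_iff, hu0 i, hut i]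
  have e2 : ∀ i, (t i / u i ^ (1 / 2 : ℝ)) ^ 2 = t i ^ 2 / u i := fun i => by
    rw [div_eq_mul_inv, mul_pow, ← ENNReal.inv_pow, e, div_eq_mul_inv]
  simpa only [e, e1, e2] using h

/-- A weighted Schur-type bound for products of matrices whose inner index is partitioned
into the fibers of `w`. -/
lemma ENNReal.tsum_tsum_sq_mul_le {X Y L : Type*} (w : L → ℕ) (f : X → L → ℝ≥0∞)
    (g : L → Y → ℝ≥0∞) (u : ℕ → ℝ≥0∞) (hu0 : ∀ i, u i ≠ 0) (hut : ∀ i, u i ≠ ∞) (D : ℝ≥0∞)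
    (h : ∀ k, (∑' x, ∑' e : {e // w e = k}, f x e ^ 2) *
      (∑' y, ∑' e : {e // w e = k}, g e y ^ 2) ≤ D * u k ^ 2) :
    ∑' x, ∑' y, (∑' e, f x e * g e y) ^ 2 ≤ D * (∑' k, u k) ^ 2 := by
  set F : X → ℕ → ℝ≥0∞ := fun x k => ∑' e : {e // w e = k}, f x e ^ 2
  set G : Y → ℕ → ℝ≥0∞ := fun y k => ∑' e : {e // w e = k}, g e y ^ 2
  have h1 : ∀ x y, (∑' e, f x e * g e y) ^ 2 ≤
      (∑' k, u k) * ∑' k, F x k * G y k / u k := by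
    intro x y
    have e : ∑' e, f x e * g e y = ∑' k, ∑' e : {e // w e = k}, f x e * g e y := by
      rw [← (Equiv.sigmaFiberEquiv w).tsum_eq, ENNReal.tsum_sigma']
      rfl
    rw [e]
    refine (ENNReal.tsum_sq_le_weighted u _ hu0 hut).trans ?_
    gcongr with k
    exact ENNReal.tsum_mul_sq_le _ _
  calc ∑' x, ∑' y, (∑' e, f x e * g e y) ^ 2
      ≤ ∑' x, ∑' y, (∑' k, u k) * ∑' k, F x k * G y k / u k := by
        gcongr with x y; exact h1 x y
    _ = (∑' k, u k) * ∑' k, (∑' x, F x k) * (∑' y, G y k) / u k := by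
        simp_rw [ENNReal.tsum_mul_left]
        congr 1
        have : ∀ x, ∑' y, ∑' k, F x k * G y k / u k = ∑' k, ∑' y, F x k * G y k / u k :=
          fun x => ENNReal.tsum_comm
        simp_rw [this]
        rw [ENNReal.tsum_comm]
        simp_rw [div_eq_mul_inv, ENNReal.tsum_mul_right, ENNReal.tsum_mul_left,
          ENNReal.tsum_mul_right]
    _ ≤ (∑' k, u k) * ∑' k, D * u k := by
        gcongr with k
        refine ENNReal.div_le_of_le_mul ((h k).trans_eq ?_)
        ring
    _ = _ := by rw [ENNReal.tsum_mul_left]; ring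

lemma frobSq_nonneg (M : Matrix (Fin 2) (Fin 2) ℝ) : 0 ≤ frobSq M := by
  unfold frobSq; positivity

lemma abs_mul_apply_le_sqrt_frobSq (M N : Matrix (Fin 2) (Fin 2) ℝ) (i j : Fin 2) :
    |(M * N) i j| ≤ √(frobSq M) * √(frobSq N) := by
  rw [← Real.sqrt_mul (frobSq_nonneg M)]
  apply Real.abs_le_sqrt
  rw [Matrix.mul_apply]
  refine (Finset.sum_mul_sq_le_sq_mul_sq _ _ _).trans ?_
  refine mul_le_mul ?_ (Finset.sum_le_sum fun k _ => ?_) (by positivity) (frobSq_nonneg M)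
  · exact Finset.single_le_sum (f := fun i => ∑ j, M i j ^ 2) (fun _ _ => by positivity)
      (Finset.mem_univ i)
  · exact Finset.single_le_sum (f := fun j => N k j ^ 2) (fun _ _ => by positivity)
      (Finset.mem_univ j)

lemma hsBlock_nonneg {L : Type*} (w : L → ℕ) (A : L → L → Matrix (Fin 2) (Fin 2) ℝ) (a b : L) :
    0 ≤ hsBlock w A a b :=
  Real.sqrt_nonneg _

lemma tsum_tsum_ofReal_frobSq {L : Type*} (w : L → ℕ) (A : L → L → Matrix (Fin 2) (Fin 2) ℝ)
    (a b : L) (hA : Summable fun p : {c : L // w c = w a} × {d : L // w d = w b} =>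
      frobSq (A p.1.1 p.2.1)) :
    ∑' c : {c : L // w c = w a}, ∑' d : {d : L // w d = w b}, ENNReal.ofReal (frobSq (A c d)) =
      ENNReal.ofReal (hsBlock w A a b ^ 2) := by
  unfold hsBlock
  rw [Real.sq_sqrt (tsum_nonneg fun _ => frobSq_nonneg _),
    ENNReal.ofReal_tsum_of_nonneg (fun _ => frobSq_nonneg _) hA]
  exact ENNReal.tsum_prod.symm

lemma ENNReal.ofReal_sqrt_sq {x : ℝ} (hx : 0 ≤ x) :
    ENNReal.ofReal (√x) ^ 2 = ENNReal.ofReal x := by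
  rw [← ENNReal.ofReal_pow (Real.sqrt_nonneg x), Real.sq_sqrt hx]

/-- If `∑ ‖A(c,e)‖ ‖B(e,d)‖` is finite, then the entry sums of `AB` at `(c,d)` converge absolutely
and are controlled by it. -/
lemma frobSq_infMul_le {L : Type*} (A B : L → L → Matrix (Fin 2) (Fin 2) ℝ) (c d : L)
    (h : ∑' e, ENNReal.ofReal (√(frobSq (A c e))) * ENNReal.ofReal (√(frobSq (B e d))) ≠ ∞) :
    (∀ i j, Summable fun e => |(A c e * B e d) i j|) ∧
      ENNReal.ofReal (frobSq (infMul A B c d)) ≤ 4 *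
        (∑' e, ENNReal.ofReal (√(frobSq (A c e))) * ENNReal.ofReal (√(frobSq (B e d)))) ^ 2 := by
  have hs : Summable fun e => √(frobSq (A c e)) * √(frobSq (B e d)) := by
    refine (ENNReal.summable_toReal h).congr fun e => ?_
    rw [ENNReal.toReal_mul, ENNReal.toReal_ofReal (Real.sqrt_nonneg _),
      ENNReal.toReal_ofReal (Real.sqrt_nonneg _)]
  have habs : ∀ i j, Summable fun e => |(A c e * B e d) i j| := fun i j =>
    Summable.of_nonneg_of_le (fun _ => abs_nonneg _)
      (fun e => abs_mul_apply_le_sqrt_frobSq _ _ i j) hs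
  refine ⟨habs, ?_⟩
  have hn : ∀ e, 0 ≤ √(frobSq (A c e)) * √(frobSq (B e d)) := fun _ => by positivity
  set S := ∑' e, √(frobSq (A c e)) * √(frobSq (B e d)) with hS
  have hS0 : 0 ≤ S := tsum_nonneg hn
  have hE : ∑' e, ENNReal.ofReal (√(frobSq (A c e))) * ENNReal.ofReal (√(frobSq (B e d))) =
      ENNReal.ofReal S := by
    rw [hS, ENNReal.ofReal_tsum_of_nonneg hn hs]
    exact tsum_congr fun e => (ENNReal.ofReal_mul (Real.sqrt_nonneg _)).symm
  have hent : ∀ i j, infMul A B c d i j ^ 2 ≤ S ^ 2 := by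
    intro i j
    rw [sq_le_sq, abs_of_nonneg hS0]
    calc |∑' e, (A c e * B e d) i j| ≤ ∑' e, |(A c e * B e d) i j| :=
          norm_tsum_le_tsum_norm (f := fun e => (A c e * B e d) i j) (habs i j)
      _ ≤ S := (habs i j).tsum_le_tsum (fun e => abs_mul_apply_le_sqrt_frobSq _ _ i j) hs
  have : frobSq (infMul A B c d) ≤ 4 * S ^ 2 := by
    simp only [frobSq, Fin.sum_univ_two]
    linarith [hent 0 0, hent 0 1, hent 1 0, hent 1 1]
  rw [hE]
  refine (ENNReal.ofReal_le_ofReal this).trans_eq ?_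
  rw [ENNReal.ofReal_mul (by norm_num), ENNReal.ofReal_pow hS0]
  norm_num

/-- Block estimate for a product, given summable weights `v` dominating the products of the
block norms of the factors. -/
lemma hsBlock_infMul_le {L : Type*} (w : L → ℕ) (A B : L → L → Matrix (Fin 2) (Fin 2) ℝ)
    (a b : L) (v : ℕ → ℝ) (hv : ∀ k, 0 < v k) (hvs : Summable v) (D : ℝ) (hD : 0 ≤ D)
    (hA : ∀ a b : L, Summable fun p : {c : L // w c = w a} × {d : L // w d = w b} =>
      frobSq (A p.1.1 p.2.1))
    (hB : ∀ a b : L, Summable fun p : {c : L // w c = w a} × {d : L // w d = w b} =>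
      frobSq (B p.1.1 p.2.1))
    (h : ∀ e, hsBlock w A a e * hsBlock w B e b ≤ D * v (w e)) :
    (∀ i j, Summable fun e => |(A a e * B e b) i j|) ∧
      hsBlock w (infMul A B) a b ≤ 2 * D * ∑' k, v k := by
  set f : {c : L // w c = w a} → L → ℝ≥0∞ := fun c e => ENNReal.ofReal (√(frobSq (A c e)))
  set g : L → {d : L // w d = w b} → ℝ≥0∞ := fun e d => ENNReal.ofReal (√(frobSq (B e d)))
  have hv0 : 0 ≤ ∑' k, v k := tsum_nonneg fun k => (hv k).le
  have key := ENNReal.tsum_tsum_sq_mul_le w f g (fun k => ENNReal.ofReal (v k))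
    (fun k => by simpa using hv k) (fun k => ENNReal.ofReal_ne_top) (ENNReal.ofReal (D ^ 2)) (by
      intro k
      by_cases hk : ∃ e, w e = k
      · obtain ⟨e, rfl⟩ := hk
        simp only [f, g, ENNReal.ofReal_sqrt_sq (frobSq_nonneg _)]
        rw [ENNReal.tsum_comm (α := {d : L // w d = w b}), tsum_tsum_ofReal_frobSq w A a e (hA a e),
          tsum_tsum_ofReal_frobSq w B e b (hB e b), ← ENNReal.ofReal_mul (sq_nonneg _),
          ← ENNReal.ofReal_pow (hv _).le, ← ENNReal.ofReal_mul (sq_nonneg _), ← mul_pow, ← mul_pow]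
        exact ENNReal.ofReal_le_ofReal (pow_le_pow_left₀
          (mul_nonneg (hsBlock_nonneg _ _ _ _) (hsBlock_nonneg _ _ _ _)) (h e) 2)
      · have : IsEmpty {e // w e = k} := ⟨fun e => hk ⟨e.1, e.2⟩⟩
        simp)
  rw [← ENNReal.ofReal_tsum_of_nonneg (fun k => (hv k).le) hvs, ← ENNReal.ofReal_pow hv0,
    ← ENNReal.ofReal_mul (sq_nonneg _), ← mul_pow] at key
  have hfin : ∀ c d, ∑' e, f c e * g e d ≠ ∞ := by
    intro c d hc
    have := ((ENNReal.le_tsum d).trans (ENNReal.le_tsum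
      (f := fun c => ∑' d, (∑' e, f c e * g e d) ^ 2) c)).trans key
    rw [hc] at this
    simp at this
  refine ⟨(frobSq_infMul_le A B a b (hfin ⟨a, rfl⟩ ⟨b, rfl⟩)).1, ?_⟩
  have hR : 0 ≤ 2 * D * ∑' k, v k := by positivity
  have hle : ∑' p : {c : L // w c = w a} × {d : L // w d = w b},
      ENNReal.ofReal (frobSq (infMul A B p.1.1 p.2.1)) ≤
        ENNReal.ofReal ((2 * D * ∑' k, v k) ^ 2) := by
    calc _ ≤ ∑' p : {c : L // w c = w a} × {d : L // w d = w b},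
          4 * (∑' e, f p.1 e * g e p.2) ^ 2 := by
          gcongr with p
          exact (frobSq_infMul_le A B p.1 p.2 (hfin p.1 p.2)).2
      _ = 4 * ∑' c, ∑' d, (∑' e, f c e * g e d) ^ 2 := by
          rw [ENNReal.tsum_mul_left, ENNReal.tsum_prod']
      _ ≤ 4 * ENNReal.ofReal ((D * ∑' k, v k) ^ 2) := by gcongr
      _ = _ := by
          rw [show (2 * D * ∑' k, v k) ^ 2 = 4 * (D * ∑' k, v k) ^ 2 by ring,
            ENNReal.ofReal_mul (by norm_num)]
          norm_num
  have hsum : Summable fun p : {c : L // w c = w a} × {d : L // w d = w b} =>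
      frobSq (infMul A B p.1.1 p.2.1) :=
    (ENNReal.summable_toReal (hle.trans_lt ENNReal.ofReal_lt_top).ne).congr fun p =>
      ENNReal.toReal_ofReal (frobSq_nonneg _)
  refine Real.sqrt_le_iff.2 ⟨hR, ?_⟩
  rwa [← ENNReal.ofReal_tsum_of_nonneg (fun _ => frobSq_nonneg _) hsum,
    ENNReal.ofReal_le_ofReal_iff (sq_nonneg _)] at hle

/-- The kernel `(1 + |j|)^(-(1 + 2β))` on the integers. -/
noncomputable def intKernel (β : ℝ) (j : ℤ) : ℝ := (1 + |(j : ℝ)|) ^ (-(1 + 2 * β))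

lemma intKernel_pos (β : ℝ) (j : ℤ) : 0 < intKernel β j := by
  unfold intKernel; positivity

lemma summable_intKernel {β : ℝ} (hβ : 0 < β) : Summable (intKernel β) := by
  have h : Summable fun n : ℕ => ((n + 1 : ℕ) : ℝ) ^ (-(1 + 2 * β)) :=
    (summable_nat_add_iff 1).2 (Real.summable_nat_rpow.2 (by linarith))
  refine Summable.of_nat_of_neg ?_ ?_ <;>
  · refine h.congr fun n => ?_
    simp [intKernel, add_comm]

/-- Weights centred at `1` and at `m`. -/
noncomputable def shiftWeight (β : ℝ) (m k : ℕ) : ℝ :=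
  intKernel β ((k : ℤ) - 1) + intKernel β ((k : ℤ) - m)

lemma shiftWeight_pos (β : ℝ) (m k : ℕ) : 0 < shiftWeight β m k :=
  add_pos (intKernel_pos _ _) (intKernel_pos _ _)

lemma injective_natCast_sub (m : ℤ) : Function.Injective fun k : ℕ => (k : ℤ) - m :=
  fun x y h => by simpa using h

lemma summable_shiftWeight {β : ℝ} (hβ : 0 < β) (m : ℕ) : Summable (shiftWeight β m) :=
  ((summable_intKernel hβ).comp_injective (injective_natCast_sub 1)).add
    ((summable_intKernel hβ).comp_injective (injective_natCast_sub m))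

lemma tsum_shiftWeight_le {β : ℝ} (hβ : 0 < β) (m : ℕ) :
    ∑' k, shiftWeight β m k ≤ 2 * ∑' j, intKernel β j := by
  have hs := summable_intKernel hβ
  have h : ∀ m : ℤ, ∑' k : ℕ, intKernel β ((k : ℤ) - m) ≤ ∑' j, intKernel β j := fun m =>
    tsum_comp_le_tsum_of_inj hs (fun j => (intKernel_pos β j).le) (injective_natCast_sub m)
  have := Summable.tsum_add (hs.comp_injective (injective_natCast_sub 1))
    (hs.comp_injective (injective_natCast_sub m))
  simp only [Function.comp_apply] at this
  calc ∑' k, shiftWeight β m k = _ := this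
    _ ≤ _ := by linarith [h 1, h m]

lemma rpow_mul_le_rpow_add {x y β : ℝ} (hx : 0 < x) (hy : 0 < y) (hβ : 0 < β) :
    x ^ (2 * β) * y ≤ x ^ (1 + 2 * β) + y ^ (1 + 2 * β) := by
  rw [Real.rpow_add hx, Real.rpow_add hy, Real.rpow_one, Real.rpow_one]
  have hx' : 0 < x ^ (2 * β) := by positivity
  have hy' : 0 < y ^ (2 * β) := by positivity
  rcases le_total x y with h | h
  · have : x ^ (2 * β) ≤ y ^ (2 * β) := by gcongr
    nlinarith [mul_pos hx hx']
  · nlinarith [mul_pos hy hy']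

lemma one_le_mul_shiftWeight {β : ℝ} (hβ : 0 < β) (m k : ℕ) (hk : 1 ≤ k) :
    1 ≤ (1 + |(m : ℝ) - k|) * (k : ℝ) ^ β * (k : ℝ) ^ β * shiftWeight β m k := by
  have hk1 : (1 : ℝ) ≤ k := by exact_mod_cast hk
  have hk0 : (0 : ℝ) < k := by linarith
  have hy : 0 < 1 + |(m : ℝ) - k| := by positivity
  have h := rpow_mul_le_rpow_add (inv_pos.2 hk0) (inv_pos.2 hy) hβ
  have hw : shiftWeight β m k =
      (k : ℝ)⁻¹ ^ (1 + 2 * β) + (1 + |(m : ℝ) - k|)⁻¹ ^ (1 + 2 * β) := by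
    simp only [shiftWeight, intKernel]
    push_cast
    rw [abs_of_nonneg (sub_nonneg.2 hk1), abs_sub_comm (k : ℝ) m, Real.inv_rpow hk0.le,
      Real.inv_rpow hy.le, Real.rpow_neg (by linarith), Real.rpow_neg hy.le]
    ring_nf
  rw [← hw, Real.inv_rpow hk0.le, two_mul, Real.rpow_add hk0] at h
  have hkb : 0 < (k : ℝ) ^ β := by positivity
  calc (1 : ℝ) = (1 + |(m : ℝ) - k|) * (k : ℝ) ^ β * (k : ℝ) ^ β *
        (((k : ℝ) ^ β * (k : ℝ) ^ β)⁻¹ * (1 + |(m : ℝ) - k|)⁻¹) := by field_simp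
    _ ≤ _ := by gcongr

/-- Lemma 4.1(i): for `β > 0` there is `C = C(β)` such that if `|A|_{β+} ≤ KA` and
`|B|_β ≤ KB` then the entry sums of `AB` and `BA` converge absolutely and
`|AB|_β, |BA|_β ≤ C · KA · KB`. -/
theorem stmt_14 (β : ℝ) (hβ : 0 < β) :
    ∃ C : ℝ, 0 < C ∧
      ∀ (L : Type) (_ : Countable L) (w : L → ℕ), (∀ a, 1 ≤ w a) →
      ∀ (A B : L → L → Matrix (Fin 2) (Fin 2) ℝ) (KA KB : ℝ),
        (∀ a b : L, Summable fun p : {c : L // w c = w a} × {d : L // w d = w b} =>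
          frobSq (A p.1.1 p.2.1)) →
        (∀ a b : L, Summable fun p : {c : L // w c = w a} × {d : L // w d = w b} =>
          frobSq (B p.1.1 p.2.1)) →
        (∀ a b : L, (1 + |(w a : ℝ) - (w b : ℝ)|) * (w a : ℝ) ^ β * (w b : ℝ) ^ β *
          hsBlock w A a b ≤ KA) →
        (∀ a b : L, (w a : ℝ) ^ β * (w b : ℝ) ^ β * hsBlock w B a b ≤ KB) →
        (∀ c d : L, ∀ i j : Fin 2, Summable fun e : L => |(A c e * B e d) i j|) ∧
        (∀ c d : L, ∀ i j : Fin 2, Summable fun e : L => |(B c e * A e d) i j|) ∧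
        (∀ a b : L, (w a : ℝ) ^ β * (w b : ℝ) ^ β * hsBlock w (infMul A B) a b ≤
          C * KA * KB) ∧
        (∀ a b : L, (w a : ℝ) ^ β * (w b : ℝ) ^ β * hsBlock w (infMul B A) a b ≤
          C * KA * KB) := by
  set T := ∑' j, intKernel β j with hT
  have hT0 : 0 < T :=
    (summable_intKernel hβ).tsum_pos (fun j => (intKernel_pos β j).le) 0 (intKernel_pos β 0)
  refine ⟨4 * T, by positivity, ?_⟩
  intro L _ w hw A B KA KB hA hB hKA hKB
  have hwp : ∀ a, 0 < (w a : ℝ) ^ β := fun a =>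
    Real.rpow_pos_of_pos (by exact_mod_cast hw a) β
  have hKA0 : ∀ _ : L, 0 ≤ KA := fun a => le_trans
    (mul_nonneg (by positivity) (hsBlock_nonneg w A a a)) (hKA a a)
  have hKB0 : ∀ _ : L, 0 ≤ KB := fun a => le_trans
    (mul_nonneg (by positivity) (hsBlock_nonneg w B a a)) (hKB a a)
  have main : ∀ (M N : L → L → Matrix (Fin 2) (Fin 2) ℝ),
      (∀ a b : L, Summable fun p : {c : L // w c = w a} × {d : L // w d = w b} =>
        frobSq (M p.1.1 p.2.1)) →
      (∀ a b : L, Summable fun p : {c : L // w c = w a} × {d : L // w d = w b} =>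
        frobSq (N p.1.1 p.2.1)) →
      ∀ (m : ℕ) (a b : L),
      (∀ e, (w a : ℝ) ^ β * (w b : ℝ) ^ β * ((1 + |(m : ℝ) - w e|) * (w e : ℝ) ^ β *
        (w e : ℝ) ^ β * (hsBlock w M a e * hsBlock w N e b)) ≤ KA * KB) →
      (∀ i j : Fin 2, Summable fun e : L => |(M a e * N e b) i j|) ∧
        (w a : ℝ) ^ β * (w b : ℝ) ^ β * hsBlock w (infMul M N) a b ≤ 4 * T * KA * KB := by
    intro M N hM hN m a b h
    have hab : 0 < (w a : ℝ) ^ β * (w b : ℝ) ^ β := mul_pos (hwp a) (hwp b)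
    have hD : 0 ≤ KA * KB / ((w a : ℝ) ^ β * (w b : ℝ) ^ β) :=
      div_nonneg (mul_nonneg (hKA0 a) (hKB0 a)) hab.le
    obtain ⟨h1, h2⟩ := hsBlock_infMul_le w M N a b (shiftWeight β m) (shiftWeight_pos β m)
      (summable_shiftWeight hβ m) _ hD hM hN (fun e => by
        have hH : 0 ≤ hsBlock w M a e * hsBlock w N e b :=
          mul_nonneg (hsBlock_nonneg _ _ _ _) (hsBlock_nonneg _ _ _ _)
        have hv := shiftWeight_pos β m (w e)
        rw [div_mul_eq_mul_div, le_div_iff₀ hab]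
        calc hsBlock w M a e * hsBlock w N e b * ((w a : ℝ) ^ β * (w b : ℝ) ^ β)
            = hsBlock w M a e * hsBlock w N e b * ((w a : ℝ) ^ β * (w b : ℝ) ^ β) * 1 := by ring
          _ ≤ hsBlock w M a e * hsBlock w N e b * ((w a : ℝ) ^ β * (w b : ℝ) ^ β) *
              ((1 + |(m : ℝ) - w e|) * (w e : ℝ) ^ β * (w e : ℝ) ^ β *
                shiftWeight β m (w e)) := by
              gcongr
              exact one_le_mul_shiftWeight hβ m (w e) (hw e)
          _ = (w a : ℝ) ^ β * (w b : ℝ) ^ β * ((1 + |(m : ℝ) - w e|) * (w e : ℝ) ^ β *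
                (w e : ℝ) ^ β * (hsBlock w M a e * hsBlock w N e b)) *
                shiftWeight β m (w e) := by ring
          _ ≤ KA * KB * shiftWeight β m (w e) := mul_le_mul_of_nonneg_right (h e) hv.le)
    refine ⟨h1, ?_⟩
    calc (w a : ℝ) ^ β * (w b : ℝ) ^ β * hsBlock w (infMul M N) a b
        ≤ (w a : ℝ) ^ β * (w b : ℝ) ^ β * (2 * (KA * KB / ((w a : ℝ) ^ β * (w b : ℝ) ^ β)) *
          (2 * T)) := by
          gcongr
          exact h2.trans (by gcongr; exact tsum_shiftWeight_le hβ m)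
      _ = 4 * T * KA * KB := by
          have := hwp a
          have := hwp b
          field_simp
          ring
  have hAB := fun a b => main A B hA hB (w a) a b fun e => by
    calc _ = ((1 + |(w a : ℝ) - w e|) * (w a : ℝ) ^ β * (w e : ℝ) ^ β * hsBlock w A a e) *
          ((w e : ℝ) ^ β * (w b : ℝ) ^ β * hsBlock w B e b) := by ring
      _ ≤ KA * KB := mul_le_mul (hKA a e) (hKB e b)
          (mul_nonneg (by positivity) (hsBlock_nonneg _ _ _ _)) (hKA0 a)
  have hBA := fun a b => main B A hB hA (w b) a b fun e => by
    calc _ = ((1 + |(w e : ℝ) - w b|) * (w e : ℝ) ^ β * (w b : ℝ) ^ β * hsBlock w A e b) *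
          ((w a : ℝ) ^ β * (w e : ℝ) ^ β * hsBlock w B a e) := by
          rw [abs_sub_comm (w b : ℝ)]; ring
      _ ≤ KA * KB := mul_le_mul (hKA e b) (hKB a e)
          (mul_nonneg (by positivity) (hsBlock_nonneg _ _ _ _)) (hKA0 a)
  exact ⟨fun c d => (hAB c d).1, fun c d => (hBA c d).1, fun a b => (hAB a b).2,
    fun a b => (hBA a b).2⟩
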